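/- arXiv:1112.4226 — 2 statements merged into one kernel-verified Lean document; each statement's English description precedes it below -/
import Mathlib

section
/- Completeness of the Kirillov vectors in the unitary principal series: fix t ∈ ℝ and write ν = it. If g : ℝ → ℂ is infinitely differentiable with compact support contained in ℝ ∖ {0}, and ∫_{ℝ∖{0}} g(u) · conj(𝒦_ℓ(u,it)) · du/|u| = 0 for every ℓ ∈ ℤ, then g is identically zero. -/
open MeasureTheory

/-- The Kirillov vector 𝒦_ℓ(u,ν), the value at a[|u|] of the Jacquet transform 𝒜^{sgn u}
of the weight-2ℓ weight function on SL(2,ℝ). -/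
noncomputable def Kvec (ℓ : ℤ) (ν : ℂ) (u : ℝ) : ℂ :=
  (Real.pi : ℂ) ^ ν / Complex.Gamma (ν + (ℓ.natAbs : ℂ) + 1 / 2) *
    ∑ j ∈ Finset.range (ℓ.natAbs + 1),
      (-(Real.pi : ℂ)) ^ j * ((2 * ℓ.natAbs).choose (2 * j) : ℂ) *
        Complex.Gamma ((ℓ.natAbs : ℂ) - (j : ℂ) + 1 / 2) * ((|u| : ℝ) : ℂ) ^ ((j : ℂ) + 1 / 2) *
        ∫ t in Set.Ioi (0 : ℝ),
          (t : ℂ) ^ (ν - 1) *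
            (((Real.sqrt t + Real.sign (u * (ℓ : ℝ)) / Real.sqrt t) ^ (2 * j) : ℝ) : ℂ) *
            (Real.exp (-(Real.pi * |u| * (t + 1 / t))) : ℂ)

/-- The integrand of a polynomially weighted Gaussian Fourier integral. -/
noncomputable def gaussWeight (r : ℝ) (a : ℂ) (b : ℝ) (k : ℕ) (x : ℝ) : ℂ :=
  (a + Complex.I * x) ^ k * Complex.exp (-(r : ℂ) * (x : ℂ) ^ 2 - 2 * Real.pi * Complex.I * b * x)

/-- The Gaussian Fourier integral of the polynomial `(a + i x) ^ k`. -/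
noncomputable def gaussMoment (r : ℝ) (a : ℂ) (b : ℝ) (k : ℕ) : ℂ :=
  ∫ x : ℝ, gaussWeight r a b k x

lemma norm_gaussExp (r b x : ℝ) :
    ‖Complex.exp (-(r : ℂ) * (x : ℂ) ^ 2 - 2 * Real.pi * Complex.I * b * x)‖
      = Real.exp (-r * x ^ 2) := by
  rw [Complex.norm_exp]
  congr 1
  have : (-(r : ℂ) * (x : ℂ) ^ 2 - 2 * Real.pi * Complex.I * b * x)
      = ((-r * x ^ 2 : ℝ) : ℂ) + ((-2 * Real.pi * b * x : ℝ) : ℂ) * Complex.I := by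
    push_cast; ring
  rw [this, Complex.add_re, Complex.ofReal_re, Complex.re_ofReal_mul]
  simp

lemma integrable_pow_mul_gaussExp {r : ℝ} (hr : 0 < r) (m : ℕ) :
    Integrable fun x : ℝ => x ^ m * Real.exp (-r * x ^ 2) := by
  have h := integrable_rpow_mul_exp_neg_mul_sq hr (s := m)
    (lt_of_lt_of_le (by norm_num) (Nat.cast_nonneg m))
  simpa [Real.rpow_natCast] using h

lemma integrable_pow_mul_gaussWeight {r : ℝ} (hr : 0 < r) (a : ℂ) (b : ℝ) (k : ℕ) :
    ∀ m : ℕ, Integrable fun x : ℝ => (x : ℂ) ^ m * gaussWeight r a b k x := by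
  induction k with
  | zero =>
    intro m
    refine (integrable_pow_mul_gaussExp hr m).mono
      (by unfold gaussWeight; fun_prop) (Filter.Eventually.of_forall fun x => ?_)
    simp only [gaussWeight, norm_mul, norm_gaussExp, pow_zero, one_mul, norm_pow,
      Complex.norm_real, Real.norm_eq_abs, Real.abs_exp, le_refl]
  | succ k ih =>
    intro m
    refine (((ih m).const_mul a).add ((ih (m + 1)).const_mul Complex.I)).congr
      (Filter.Eventually.of_forall fun x => ?_)
    simp only [gaussWeight, Pi.add_apply]
    ring

lemma integrable_gaussWeight {r : ℝ} (hr : 0 < r) (a : ℂ) (b : ℝ) (k : ℕ) :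
    Integrable (gaussWeight r a b k) := by
  simpa using integrable_pow_mul_gaussWeight hr a b k 0

lemma gaussMoment_succ {r : ℝ} (hr : 0 < r) (a : ℂ) (b : ℝ) (k : ℕ) :
    gaussMoment r a b (k + 1) =
      (a + Real.pi * b / r) * gaussMoment r a b k - k / (2 * r) * gaussMoment r a b (k - 1) := by
  have hi := integrable_gaussWeight hr a b
  have hd : ∀ x : ℝ, HasDerivAt (gaussWeight r a b k)
      (k * Complex.I * gaussWeight r a b (k - 1) x + (2 * r * Complex.I * gaussWeight r a b (k + 1) x
        - (2 * r * Complex.I * a + 2 * Real.pi * Complex.I * b) * gaussWeight r a b k x)) x := by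
    intro x
    have h1 : HasDerivAt (fun x : ℝ => (x : ℂ)) 1 x := Complex.ofRealCLM.hasDerivAt
    have h2 := ((h1.const_mul Complex.I).const_add a).pow k
    have h3 := (((h1.pow 2).const_mul (-(r : ℂ))).sub
      (h1.const_mul (2 * Real.pi * Complex.I * b))).cexp
    refine (h2.mul h3).congr_deriv ?_
    simp only [gaussWeight, Pi.sub_apply, Pi.pow_apply]
    have hI : Complex.I ^ 2 = -1 := Complex.I_sq
    ring_nf
    simp only [hI]
    ring
  have h0 := integral_eq_zero_of_hasDerivAt_of_integrable hd
    (((hi _).const_mul _).add (((hi _).const_mul _).sub ((hi _).const_mul _))) (hi k)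
  have hs : Integrable fun x : ℝ => 2 * r * Complex.I * gaussWeight r a b (k + 1) x
      - (2 * r * Complex.I * a + 2 * Real.pi * Complex.I * b) * gaussWeight r a b k x :=
    ((hi _).const_mul _).sub ((hi _).const_mul _)
  rw [integral_add ((hi _).const_mul _) hs, integral_sub ((hi _).const_mul _) ((hi _).const_mul _)] at h0
  simp only [integral_const_mul] at h0
  change _ * gaussMoment r a b (k - 1) + (_ * gaussMoment r a b (k + 1)
    - _ * gaussMoment r a b k) = 0 at h0
  have hr' : (r : ℂ) ≠ 0 := by exact_mod_cast hr.ne'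
  have hI : Complex.I ≠ 0 := Complex.I_ne_zero
  have h1 : (2 * r * Complex.I) * (gaussMoment r a b (k + 1) -
      ((a + Real.pi * b / r) * gaussMoment r a b k - k / (2 * r) * gaussMoment r a b (k - 1)))
      = 0 := by
    rw [← h0]; field_simp; ring
  exact sub_eq_zero.mp ((mul_eq_zero.mp h1).resolve_left (by simp [hr', hI]))

lemma gaussMoment_zero {r : ℝ} (hr : 0 < r) (a a' : ℂ) (b : ℝ) :
    gaussMoment r a b 0 = Complex.exp (-(Real.pi ^ 2 * b ^ 2 / r)) * gaussMoment r a' 0 0 := by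
  have hr' : (r : ℂ) ≠ 0 := by exact_mod_cast hr.ne'
  have key : ∀ (a : ℂ) (b : ℝ), gaussMoment r a b 0
      = (Real.pi / (r : ℂ)) ^ (1 / 2 : ℂ) * Complex.exp (-(Real.pi ^ 2 * b ^ 2 / r)) := by
    intro a b
    have h := integral_cexp_quadratic (b := -(r : ℂ)) (by simpa using hr)
      (-(2 * Real.pi * Complex.I * b)) 0
    rw [neg_neg] at h
    rw [gaussMoment]
    convert! h using 3
    · simp only [gaussWeight]; ring_nf
    · have hI : Complex.I ^ 2 = -1 := Complex.I_sq
      field_simp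
      simp only [hI]
      ring
  rw [key a b, key a' 0]
  simp [mul_comm]

/-- Shift of contour for polynomially weighted Gaussians. -/
lemma gaussMoment_shift {r : ℝ} (hr : 0 < r) (a : ℂ) (b : ℝ) (k : ℕ) :
    gaussMoment r a b k =
      Complex.exp (-(Real.pi ^ 2 * b ^ 2 / r)) * gaussMoment r (a + Real.pi * b / r) 0 k := by
  induction k using Nat.strong_induction_on with
  | _ k ih =>
    match k with
    | 0 => exact gaussMoment_zero hr _ _ _
    | k + 1 =>
      rw [gaussMoment_succ hr, gaussMoment_succ hr, ih k (by omega), ih (k - 1) (by omega)]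
      simp only [Complex.ofReal_zero, mul_zero, zero_div, add_zero]
      ring

lemma integral_even_pow_mul_gaussExp {r : ℝ} (hr : 0 < r) (i : ℕ) :
    ∫ x : ℝ, x ^ (2 * i) * Real.exp (-r * x ^ 2) =
      Real.Gamma (i + 1 / 2) * r ^ (-(i : ℝ) - 1 / 2) := by
  have h1 : ∫ x : ℝ, x ^ (2 * i) * Real.exp (-r * x ^ 2)
      = ∫ x : ℝ, (fun y : ℝ => y ^ (2 * i) * Real.exp (-r * y ^ 2)) |x| := by
    congr 1; ext x
    simp [pow_mul]
  have h2 := integral_rpow_mul_exp_neg_mul_rpow (p := 2) (q := (2 * i : ℕ)) (b := r) (by norm_num)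
    (lt_of_lt_of_le (by norm_num) (Nat.cast_nonneg _)) hr
  have h3 : ∫ x in Set.Ioi (0 : ℝ), x ^ (2 * i) * Real.exp (-r * x ^ 2)
      = r ^ (-(i : ℝ) - 1 / 2) * (1 / 2) * Real.Gamma (i + 1 / 2) := by
    rw [show (-(i : ℝ) - 1 / 2) = -(((2 * i : ℕ) : ℝ) + 1) / 2 by push_cast; ring,
      show (i : ℝ) + 1 / 2 = (((2 * i : ℕ) : ℝ) + 1) / 2 by push_cast; ring, ← h2]
    refine setIntegral_congr_fun measurableSet_Ioi fun x _ => ?_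
    simp only [Real.rpow_natCast, Real.rpow_two]
  rw [h1, integral_comp_abs (f := fun y : ℝ => y ^ (2 * i) * Real.exp (-r * y ^ 2)), h3]
  ring

lemma integral_odd_pow_mul_gaussExp (r : ℝ) (i : ℕ) :
    ∫ x : ℝ, x ^ (2 * i + 1) * Real.exp (-r * x ^ 2) = 0 := by
  have h := integral_neg_eq_self (fun x : ℝ => x ^ (2 * i + 1) * Real.exp (-r * x ^ 2)) volume
  have h2 : ∀ x : ℝ, (-x) ^ (2 * i + 1) * Real.exp (-r * (-x) ^ 2)
      = -(x ^ (2 * i + 1) * Real.exp (-r * x ^ 2)) := by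
    intro x
    rw [Odd.neg_pow ⟨i, rfl⟩, neg_sq, neg_mul]
  simp only [h2, integral_neg] at h
  linarith

lemma sum_range_two_mul_add_one {M : Type*} [AddCommMonoid M] (f : ℕ → M) (n : ℕ) :
    ∑ m ∈ Finset.range (2 * n + 1), f m =
      ∑ j ∈ Finset.range (n + 1), f (2 * j) + ∑ j ∈ Finset.range n, f (2 * j + 1) := by
  induction n with
  | zero => simp
  | succ n ih =>
    rw [show 2 * (n + 1) + 1 = 2 * n + 1 + 1 + 1 by ring, Finset.sum_range_succ,
      Finset.sum_range_succ, ih, Finset.sum_range_succ _ (n + 1),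
      Finset.sum_range_succ (fun j => f (2 * j + 1)) n, show 2 * n + 1 + 1 = 2 * (n + 1) by ring]
    abel

/-- Explicit evaluation of the even Gaussian moments. -/
lemma gaussMoment_even {r : ℝ} (hr : 0 < r) (a : ℂ) (n : ℕ) :
    gaussMoment r a 0 (2 * n) = ∑ j ∈ Finset.range (n + 1),
      ((2 * n).choose (2 * j) : ℂ) * a ^ (2 * j) * (-1) ^ (n - j) *
        ((Real.Gamma ((n - j : ℕ) + 1 / 2) * r ^ (-((n - j : ℕ) : ℝ) - 1 / 2) : ℝ) : ℂ) := by
  have hE : ∀ x : ℝ, gaussWeight r a 0 (2 * n) x = ∑ m ∈ Finset.range (2 * n + 1),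
      (a ^ m * Complex.I ^ (2 * n - m) * ((2 * n).choose m : ℂ)) *
        ((x ^ (2 * n - m) * Real.exp (-r * x ^ 2) : ℝ) : ℂ) := by
    intro x
    rw [gaussWeight, add_pow, Finset.sum_mul]
    refine Finset.sum_congr rfl fun m _ => ?_
    push_cast
    rw [mul_pow]
    simp only [mul_zero, zero_mul, sub_zero]
    ring
  rw [gaussMoment]
  simp only [hE]
  rw [integral_finsetSum _ fun m _ => ((integrable_pow_mul_gaussExp hr _).ofReal).const_mul _]
  simp only [integral_const_mul, integral_complex_ofReal]
  rw [sum_range_two_mul_add_one]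
  rw [Finset.sum_eq_zero (s := Finset.range n), add_zero]
  · refine Finset.sum_congr rfl fun j hj => ?_
    have hj' : j ≤ n := by simpa [Nat.lt_succ_iff] using hj
    rw [show 2 * n - 2 * j = 2 * (n - j) by omega, integral_even_pow_mul_gaussExp hr, pow_mul Complex.I,
      Complex.I_sq]
    ring
  · intro j hj
    have hj' : j < n := by simpa using hj
    rw [show 2 * n - (2 * j + 1) = 2 * (n - j - 1) + 1 by omega, integral_odd_pow_mul_gaussExp]
    simp

/-- The elementary integrand whose Mellin integrals make up the Kirillov vectors. -/
noncomputable def kirillovTerm (ν : ℂ) (j : ℕ) (u r : ℝ) : ℂ :=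
  (r : ℂ) ^ (ν - 1) *
    ((r ^ j * (1 + Real.pi * u / r) ^ (2 * j) * Real.exp (-r - Real.pi ^ 2 * u ^ 2 / r) : ℝ) : ℂ)

lemma gaussMoment_eq_sum_kirillovTerm {r : ℝ} (hr : 0 < r) (ν : ℂ) (u : ℝ) (n : ℕ) :
    (r : ℂ) ^ (ν + n - 1 / 2) * (Real.exp (-r) : ℂ) * gaussMoment r 1 u (2 * n) =
      ∑ j ∈ Finset.range (n + 1), ((2 * n).choose (2 * j) : ℂ) * (-1) ^ (n - j) *
        (Real.Gamma ((n - j : ℕ) + 1 / 2) : ℂ) * kirillovTerm ν j u r := by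
  have hr' : (r : ℂ) ≠ 0 := by exact_mod_cast hr.ne'
  rw [gaussMoment_shift hr, gaussMoment_even hr, Finset.mul_sum, Finset.mul_sum]
  refine Finset.sum_congr rfl fun j hj => ?_
  have hj' : j ≤ n := by simpa [Nat.lt_succ_iff] using hj
  have hp : (r : ℂ) ^ (ν + n - 1 / 2) * ((r ^ (-((n - j : ℕ) : ℝ) - 1 / 2) : ℝ) : ℂ)
      = (r : ℂ) ^ (ν - 1) * (r : ℂ) ^ j := by
    rw [Complex.ofReal_cpow hr.le, ← Complex.cpow_natCast, ← Complex.cpow_add _ _ hr',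
      ← Complex.cpow_add _ _ hr']
    congr 1
    push_cast [Nat.cast_sub hj']
    ring
  rw [kirillovTerm, sub_eq_add_neg (-r), Real.exp_add]
  push_cast at hp ⊢
  linear_combination ((2 * n).choose (2 * j) : ℂ) * (1 + Real.pi * u / r) ^ (2 * j)
    * (-1) ^ (n - j) * (Real.Gamma ((n - j : ℕ) + 1 / 2) : ℂ) * Complex.exp (-r)
    * Complex.exp (-(Real.pi ^ 2 * u ^ 2 / r)) * hp

@[fun_prop]
lemma measurable_kirillovTerm (ν : ℂ) (j : ℕ) :
    Measurable fun p : ℝ × ℝ => kirillovTerm ν j p.1 p.2 := by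
  unfold kirillovTerm
  fun_prop

lemma norm_kirillovTerm_le (t : ℝ) (j : ℕ) {δ R : ℝ} (hδ : 0 < δ) :
    ∃ C : ℝ, ∀ u r : ℝ, 0 < r → δ ≤ |u| → |u| ≤ R →
      ‖kirillovTerm (Complex.I * t) j u r‖ ≤ C * Real.exp (-(r / 2)) := by
  set c := Real.pi ^ 2 * δ ^ 2 with hc
  have hc0 : 0 < c := by positivity
  refine ⟨((j + 1).factorial / c ^ (j + 1)) * (2 ^ (2 * j) * (2 * j).factorial *
    Real.exp (Real.pi * R / 2)), fun u r hr hu hR => ?_⟩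
  have hR0 : 0 ≤ R := (abs_nonneg u).trans hR
  have h1 : ‖kirillovTerm (Complex.I * t) j u r‖ =
      r ^ (-1 : ℝ) * (r ^ j * (1 + Real.pi * u / r) ^ (2 * j) *
        Real.exp (-r - Real.pi ^ 2 * u ^ 2 / r)) := by
    rw [kirillovTerm, norm_mul, Complex.norm_cpow_eq_rpow_re_of_pos hr, Complex.norm_real,
      Real.norm_of_nonneg]
    · simp
    · have : 0 ≤ (1 + Real.pi * u / r) ^ (2 * j) := by rw [pow_mul]; positivity
      positivity
  have h2 : Real.exp (-(Real.pi ^ 2 * u ^ 2 / r)) ≤ (j + 1).factorial / c ^ (j + 1) * r ^ (j + 1) := by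
    have hcu : c ≤ Real.pi ^ 2 * u ^ 2 := by
      rw [hc, ← sq_abs u]; gcongr
    have h3 := Real.pow_div_factorial_le_exp (x := c / r) (by positivity) (j + 1)
    have h4 : Real.exp (-(Real.pi ^ 2 * u ^ 2 / r)) ≤ (Real.exp (c / r))⁻¹ := by
      rw [← Real.exp_neg]; gcongr
    refine h4.trans ((inv_anti₀ (by positivity) h3).trans (le_of_eq ?_))
    rw [div_pow]; field_simp
  have h3 : (r + Real.pi * u) ^ (2 * j) ≤ 2 ^ (2 * j) * (2 * j).factorial *
      Real.exp (Real.pi * R / 2) * Real.exp (r / 2) := by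
    have h5 : |r + Real.pi * u| ≤ r + Real.pi * R := by
      refine (abs_add_le _ _).trans ?_
      rw [abs_of_pos hr, abs_mul, abs_of_pos Real.pi_pos]
      gcongr
    have h6 := Real.pow_div_factorial_le_exp (x := (r + Real.pi * R) / 2) (by positivity) (2 * j)
    have h7 : (r + Real.pi * u) ^ (2 * j) ≤ (r + Real.pi * R) ^ (2 * j) := by
      rw [← (even_two_mul j).pow_abs]; gcongr
    refine h7.trans ?_
    rw [div_le_iff₀ (by positivity), div_pow, div_le_iff₀ (by positivity)] at h6
    refine h6.trans (le_of_eq ?_)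
    rw [add_div, Real.exp_add]; ring
  have h4 : r ^ (-1 : ℝ) * (r ^ j * (1 + Real.pi * u / r) ^ (2 * j) *
        Real.exp (-r - Real.pi ^ 2 * u ^ 2 / r)) =
      (r ^ (j + 1))⁻¹ * ((r + Real.pi * u) ^ (2 * j) *
        Real.exp (-(Real.pi ^ 2 * u ^ 2 / r))) * Real.exp (-r) := by
    rw [sub_eq_add_neg, Real.exp_add, Real.rpow_neg_one,
      show 1 + Real.pi * u / r = (r + Real.pi * u) / r by field_simp, div_pow]
    field_simp
    ring
  have h5 : 0 ≤ (r + Real.pi * u) ^ (2 * j) := by rw [pow_mul]; positivity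
  rw [h1, h4]
  calc _ ≤ (r ^ (j + 1))⁻¹ * ((2 ^ (2 * j) * (2 * j).factorial *
      Real.exp (Real.pi * R / 2) * Real.exp (r / 2)) *
        ((j + 1).factorial / c ^ (j + 1) * r ^ (j + 1))) * Real.exp (-r) := by gcongr
    _ = _ := by
      rw [show -(r / 2) = r / 2 + -r by ring, Real.exp_add]
      field_simp

lemma integrableOn_exp_neg_half : IntegrableOn (fun r : ℝ => Real.exp (-(r / 2))) (Set.Ioi 0) := by
  have := integrableOn_exp_mul_Ioi (a := -(1 / 2)) (by norm_num) 0
  refine this.congr_fun (fun x _ => ?_) measurableSet_Ioi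
  simp only; congr 1; ring

lemma integrableOn_kirillovTerm (t : ℝ) (j : ℕ) {u : ℝ} (hu : u ≠ 0) :
    IntegrableOn (kirillovTerm (Complex.I * t) j u) (Set.Ioi 0) := by
  obtain ⟨C, hC⟩ := norm_kirillovTerm_le t j (R := |u|) (abs_pos.mpr hu)
  refine (integrableOn_exp_neg_half.const_mul C).mono' ?_ ?_
  · exact ((measurable_kirillovTerm _ j).comp measurable_prodMk_left).aestronglyMeasurable
  · filter_upwards [ae_restrict_mem measurableSet_Ioi] with r hr
    exact hC u r hr le_rfl le_rfl

lemma integral_kirillovTerm (ν : ℂ) (j : ℕ) {y σ : ℝ} (hy : 0 < y) (hσ : σ ^ 2 = 1) :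
    ∫ r in Set.Ioi (0 : ℝ), kirillovTerm ν j (σ * y) r =
      ((Real.pi * y : ℝ) : ℂ) ^ (ν + j) * ∫ t in Set.Ioi (0 : ℝ),
          (t : ℂ) ^ (ν - 1) * (((Real.sqrt t + σ / Real.sqrt t) ^ (2 * j) : ℝ) : ℂ) *
            (Real.exp (-(Real.pi * y * (t + 1 / t))) : ℂ) := by
  have hb : 0 < Real.pi * y := by positivity
  have hb' : ((Real.pi * y : ℝ) : ℂ) ≠ 0 := by exact_mod_cast hb.ne'
  have h := integral_comp_mul_left_Ioi' (kirillovTerm ν j (σ * y)) 0 hb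
  rw [mul_zero] at h
  rw [← h, Complex.real_smul, ← integral_const_mul, ← integral_const_mul]
  refine setIntegral_congr_fun measurableSet_Ioi fun t (ht : 0 < t) => ?_
  simp only [kirillovTerm]
  have hs : 0 < Real.sqrt t := Real.sqrt_pos.mpr ht
  have hss : Real.sqrt t ^ 2 = t := Real.sq_sqrt ht.le
  have h1 : (((Real.pi * y * t : ℝ)) : ℂ) ^ (ν - 1) =
      ((Real.pi * y : ℝ) : ℂ) ^ (ν - 1) * (t : ℂ) ^ (ν - 1) := by
    rw [Complex.ofReal_mul, Complex.mul_cpow_ofReal_nonneg hb.le ht.le]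
  have h2 : ((Real.pi * y : ℝ) : ℂ) ^ (ν + j) =
      ((Real.pi * y : ℝ) : ℂ) ^ (ν - 1) * ((Real.pi * y : ℝ) : ℂ) * ((Real.pi * y : ℝ) : ℂ) ^ j := by
    rw [show ν + j = (ν - 1) + 1 + j by ring, Complex.cpow_add _ _ hb', Complex.cpow_add _ _ hb',
      Complex.cpow_one, Complex.cpow_natCast]
  have h3 : (Real.pi * y * t) ^ j * (1 + Real.pi * (σ * y) / (Real.pi * y * t)) ^ (2 * j) =
      (Real.pi * y) ^ j * (Real.sqrt t + σ / Real.sqrt t) ^ (2 * j) := by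
    rw [pow_mul, pow_mul, ← mul_pow, ← mul_pow]
    congr 1
    have : Real.pi * (σ * y) / (Real.pi * y * t) = σ / t := by field_simp
    rw [this]
    have h4 : (Real.sqrt t + σ / Real.sqrt t) ^ 2 = t * (1 + σ / t) ^ 2 := by
      have : Real.sqrt t + σ / Real.sqrt t = Real.sqrt t * (1 + σ / t) := by
        rw [mul_add, mul_one]
        congr 1
        nth_rewrite 3 [← hss]
        field_simp
      rw [this, mul_pow, hss]
    rw [h4]; ring
  have h4 : -(Real.pi * y * t) - Real.pi ^ 2 * (σ * y) ^ 2 / (Real.pi * y * t) =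
      -(Real.pi * y * (t + 1 / t)) := by
    rw [mul_pow, hσ]; field_simp; ring
  rw [h1, h2, h3, h4]
  push_cast
  ring

/-- The integrand of the Mellin-type representation of the Kirillov vector. -/
noncomputable def kirillovKernel (ν : ℂ) (n : ℕ) (u r : ℝ) : ℂ :=
  (r : ℂ) ^ (ν + n - 1 / 2) * (Real.exp (-r) : ℂ) * gaussMoment r 1 u (2 * n)

lemma Kvec_eq_integral_kirillovKernel (ℓ : ℤ) (t : ℝ) {u ε : ℝ} (hu : u ≠ 0) (hε : ε ^ 2 = 1)
    (hεℓ : ε * ℓ.natAbs = ℓ) :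
    Kvec ℓ (Complex.I * t) u =
      (-1) ^ ℓ.natAbs / Complex.Gamma (Complex.I * t + (ℓ.natAbs : ℂ) + 1 / 2) *
        ((|u| : ℝ) : ℂ) ^ (1 / 2 - Complex.I * t) *
        ∫ r in Set.Ioi (0 : ℝ), kirillovKernel (Complex.I * t) ℓ.natAbs (ε * u) r := by
  set n := ℓ.natAbs with hn
  set ν := Complex.I * (t : ℂ) with hν
  have hy : 0 < |u| := abs_pos.mpr hu
  have hyc : ((|u| : ℝ) : ℂ) ≠ 0 := by exact_mod_cast hy.ne'
  have hπ : (Real.pi : ℂ) ≠ 0 := by exact_mod_cast Real.pi_ne_zero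
  have hε0 : ε ≠ 0 := by rintro rfl; norm_num at hε
  have hK : ∫ r in Set.Ioi (0 : ℝ), kirillovKernel ν n (ε * u) r =
      ∑ j ∈ Finset.range (n + 1), ((2 * n).choose (2 * j) : ℂ) * (-1) ^ (n - j) *
        (Real.Gamma ((n - j : ℕ) + 1 / 2) : ℂ) *
          ∫ r in Set.Ioi (0 : ℝ), kirillovTerm ν j (ε * u) r := by
    simp only [← integral_const_mul]
    rw [← integral_finsetSum _ fun j _ =>
      (integrableOn_kirillovTerm t j (mul_ne_zero hε0 hu)).const_mul _]
    exact setIntegral_congr_fun measurableSet_Ioi fun r hr =>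
      gaussMoment_eq_sum_kirillovTerm hr ν (ε * u) n
  rw [hK, Kvec, Finset.mul_sum, Finset.mul_sum]
  refine Finset.sum_congr rfl fun j hj => ?_
  have hj' : j ≤ n := by simpa [Nat.lt_succ_iff] using hj
  have hG : Complex.Gamma ((n : ℂ) - j + 1 / 2) = (Real.Gamma ((n - j : ℕ) + 1 / 2) : ℂ) := by
    rw [← Complex.Gamma_ofReal]
    push_cast [Nat.cast_sub hj']
    rfl
  have hσ : (u / |u| * ε) ^ 2 = 1 := by
    rw [mul_pow, hε, div_pow, sq_abs, div_self (pow_ne_zero 2 hu), one_mul]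
  have hI : ∫ t in Set.Ioi (0 : ℝ), (t : ℂ) ^ (ν - 1) *
        (((Real.sqrt t + Real.sign (u * (ℓ : ℝ)) / Real.sqrt t) ^ (2 * j) : ℝ) : ℂ) *
            (Real.exp (-(Real.pi * |u| * (t + 1 / t))) : ℂ) =
      ∫ t in Set.Ioi (0 : ℝ), (t : ℂ) ^ (ν - 1) *
        (((Real.sqrt t + (u / |u| * ε) / Real.sqrt t) ^ (2 * j) : ℝ) : ℂ) *
            (Real.exp (-(Real.pi * |u| * (t + 1 / t))) : ℂ) := by
    rcases Nat.eq_zero_or_pos n with h0 | h0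
    · have : j = 0 := by omega
      subst this
      simp
    · have hn' : (0 : ℝ) < n := by exact_mod_cast h0
      have : Real.sign (u * (ℓ : ℝ)) = u / |u| * ε := by
        rw [← hεℓ]
        have hε' : ε = 1 ∨ ε = -1 := by simpa using hε
        rcases hε' with rfl | rfl <;> rcases lt_or_gt_of_ne hu with h | h
        · rw [Real.sign_of_neg (by nlinarith), abs_of_neg h]; field_simp
        · rw [Real.sign_of_pos (by nlinarith), abs_of_pos h]; field_simp
        · rw [Real.sign_of_pos (by nlinarith), abs_of_neg h]; field_simp
        · rw [Real.sign_of_neg (by nlinarith), abs_of_pos h]; field_simp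
      rw [this]
  have hT := integral_kirillovTerm ν j hy hσ
  rw [show u / |u| * ε * |u| = ε * u by field_simp] at hT
  rw [hI, hT, hG, Complex.ofReal_mul, Complex.mul_cpow_ofReal_nonneg Real.pi_pos.le hy.le,
    Complex.cpow_add _ _ hπ, Complex.cpow_natCast]
  have h1 : ((|u| : ℝ) : ℂ) ^ ((j : ℂ) + 1 / 2) =
      ((|u| : ℝ) : ℂ) ^ (1 / 2 - ν) * ((|u| : ℝ) : ℂ) ^ (ν + j) := by
    rw [← Complex.cpow_add _ _ hyc]; congr 1; ring
  have h2 : (-1 : ℂ) ^ n * (-1) ^ (n - j) = (-1) ^ j := by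
    obtain ⟨k, hk⟩ := Nat.exists_eq_add_of_le hj'
    rw [hk, Nat.add_sub_cancel_left, pow_add, mul_assoc, ← pow_add, ← two_mul, pow_mul]
    simp
  rw [h1, neg_pow, ← h2]
  ring

open scoped FourierTransform

lemma integrable_mul_kirillovKernel (t : ℝ) (n : ℕ) {h : ℝ → ℂ} (hh : Integrable h) {δ R ε : ℝ}
    (hδ : 0 < δ) (hb : ∀ u, h u ≠ 0 → δ ≤ |u| ∧ |u| ≤ R) (hε : ε ^ 2 = 1) :
    Integrable (fun p : ℝ × ℝ => h p.1 * kirillovKernel (Complex.I * t) n (ε * p.1) p.2)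
      (volume.prod (volume.restrict (Set.Ioi 0))) := by
  have hpos : ∀ᵐ p : ℝ × ℝ ∂(volume.prod (volume.restrict (Set.Ioi 0))), 0 < p.2 :=
    Measure.quasiMeasurePreserving_snd.ae (ae_restrict_mem measurableSet_Ioi)
  have habs : |ε| = 1 := by rw [← sq_eq_sq₀ (abs_nonneg _) zero_le_one, sq_abs, hε, one_pow]
  have hT : ∀ j, Integrable (fun p : ℝ × ℝ => h p.1 * kirillovTerm (Complex.I * t) j (ε * p.1) p.2)
      (volume.prod (volume.restrict (Set.Ioi 0))) := by
    intro j
    obtain ⟨C, hC⟩ := norm_kirillovTerm_le t j (R := R) hδ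
    refine ((hh.norm.const_mul C).mul_prod integrableOn_exp_neg_half).mono' ?_ ?_
    · refine hh.aestronglyMeasurable.comp_fst.mul (Measurable.aestronglyMeasurable ?_)
      exact (measurable_kirillovTerm (Complex.I * t) j).comp
        ((measurable_fst.const_mul ε).prodMk measurable_snd)
    · filter_upwards [hpos] with p hp
      by_cases hp1 : h p.1 = 0
      · simp [hp1]
      · obtain ⟨h1, h2⟩ := hb _ hp1
        rw [norm_mul, mul_comm C, mul_assoc]
        gcongr
        exact hC _ _ hp (by rwa [abs_mul, habs, one_mul]) (by rwa [abs_mul, habs, one_mul])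
  have hsum := integrable_finsetSum (Finset.range (n + 1)) fun j _ =>
    (hT j).const_mul (((2 * n).choose (2 * j) : ℂ) * (-1) ^ (n - j) *
        (Real.Gamma ((n - j : ℕ) + 1 / 2) : ℂ))
  refine hsum.congr ?_
  filter_upwards [hpos] with p hp
  rw [kirillovKernel, gaussMoment_eq_sum_kirillovTerm hp, Finset.mul_sum]
  exact Finset.sum_congr rfl fun j _ => by ring

lemma gaussWeight_eq (r : ℝ) (a : ℂ) (b : ℝ) (k : ℕ) (x : ℝ) :
    gaussWeight r a b k x = gaussWeight r a 0 k x *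
      Complex.exp (((-2 * Real.pi * b * x : ℝ) : ℂ) * Complex.I) := by
  rw [gaussWeight, gaussWeight, mul_assoc ((a + Complex.I * x) ^ k), ← Complex.exp_add]
  congr 2
  push_cast
  ring

lemma integral_mul_gaussMoment {r : ℝ} (hr : 0 < r) (a : ℂ) (k : ℕ) (ε : ℝ) {h : ℝ → ℂ}
    (hh : Integrable h) :
    ∫ u : ℝ, h u * gaussMoment r a (ε * u) k = ∫ x : ℝ, gaussWeight r a 0 k x * 𝓕 h (ε * x) := by
  have hint : Integrable (Function.uncurry fun u x : ℝ => h u * gaussWeight r a (ε * u) k x)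
      (volume.prod volume) := by
    refine (hh.mul_prod (integrable_gaussWeight hr a 0 k)).mono ?_ (Filter.Eventually.of_forall ?_)
    · refine hh.aestronglyMeasurable.comp_fst.mul (Measurable.aestronglyMeasurable ?_)
      unfold gaussWeight
      fun_prop
    · intro p
      simp only [Function.uncurry, norm_mul]
      rw [gaussWeight_eq, norm_mul, Complex.norm_exp_ofReal_mul_I, mul_one]
  have h1 : ∫ u : ℝ, h u * gaussMoment r a (ε * u) k
      = ∫ u : ℝ, ∫ x : ℝ, h u * gaussWeight r a (ε * u) k x := by
    simp only [integral_const_mul, gaussMoment]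
  rw [h1, integral_integral_swap hint]
  congr 1; ext x
  rw [Real.fourier_real_eq_integral_exp_smul, ← integral_const_mul]
  congr 1; ext u
  rw [gaussWeight_eq, smul_eq_mul, show -2 * Real.pi * u * (ε * x) = -2 * Real.pi * (ε * u) * x by ring]
  ring

lemma norm_one_add_I_mul_sq (x : ℝ) : ‖(1 : ℂ) + Complex.I * x‖ ^ 2 = 1 + x ^ 2 := by
  rw [← Complex.normSq_eq_norm_sq, Complex.normSq_apply]
  simp
  ring

lemma integral_gaussWeight_mul (t : ℝ) (n : ℕ) {F : ℝ → ℂ} (hF : Continuous F) {C : ℝ}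
    (hC : ∀ x, ‖F x‖ * Real.sqrt (1 + x ^ 2) ≤ C) :
    ∫ r in Set.Ioi (0 : ℝ), (r : ℂ) ^ (Complex.I * t + n - 1 / 2) * (Real.exp (-r) : ℂ) *
        ∫ x : ℝ, gaussWeight r 1 0 (2 * n) x * F x =
      Complex.Gamma (Complex.I * t + n + 1 / 2) *
        ∫ x : ℝ, (1 + Complex.I * x) ^ (2 * n) *
          (1 / ((1 + x ^ 2 : ℝ) : ℂ)) ^ (Complex.I * t + n + 1 / 2) * F x := by
  set s : ℂ := Complex.I * t + n + 1 / 2 with hs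
  have hsre : s.re = n + 1 / 2 := by simp [hs]
  have hspos : 0 < s.re := by rw [hsre]; positivity
  set f : ℝ → ℝ → ℂ := fun r x => (r : ℂ) ^ (s - 1) *
    Complex.exp (-(((1 + x ^ 2 : ℝ) : ℂ) * r)) * ((1 + Complex.I * x) ^ (2 * n) * F x) with hf
  have hfr : ∀ r x : ℝ, (r : ℂ) ^ (Complex.I * t + n - 1 / 2) * (Real.exp (-r) : ℂ) *
      (gaussWeight r 1 0 (2 * n) x * F x) = f r x := by
    intro r x
    simp only [hf]
    rw [gaussWeight, show s - 1 = Complex.I * t + n - 1 / 2 by rw [hs]; ring, Complex.ofReal_exp,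
      show -(((1 + x ^ 2 : ℝ) : ℂ) * r) = ((-r : ℝ) : ℂ) +
        (-(r : ℂ) * (x : ℂ) ^ 2 - 2 * Real.pi * Complex.I * (0 : ℝ) * x) by push_cast; ring,
      Complex.exp_add]
    ring
  have hnorm : ∀ x r : ℝ, 0 < r → ‖f r x‖ = r ^ ((n + 1 / 2 : ℝ) - 1) *
      Real.exp (-((1 + x ^ 2) * r)) * ((1 + x ^ 2) ^ n * ‖F x‖) := by
    intro x r hr
    simp only [hf, norm_mul]
    rw [Complex.norm_cpow_eq_rpow_re_of_pos hr, Complex.sub_re, hsre, Complex.one_re, norm_pow,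
      pow_mul, norm_one_add_I_mul_sq,
      show -(((1 + x ^ 2 : ℝ) : ℂ) * r) = ((-((1 + x ^ 2) * r) : ℝ) : ℂ) by push_cast; ring,
      ← Complex.ofReal_exp, Complex.norm_real, Real.norm_of_nonneg (Real.exp_pos _).le]
  have hmeas : AEStronglyMeasurable (Function.uncurry f)
      ((volume.restrict (Set.Ioi 0)).prod volume) := by
    apply Measurable.aestronglyMeasurable
    have := hF.measurable
    simp only [hf]
    fun_prop
  have hgauss : ∀ x : ℝ, ∫ r in Set.Ioi (0 : ℝ), ‖f r x‖ =
      Real.Gamma (n + 1 / 2) * ((1 + x ^ 2) ^ (-(1 / 2) : ℝ) * ‖F x‖) := by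
    intro x
    have hx : 0 < 1 + x ^ 2 := by positivity
    rw [setIntegral_congr_fun measurableSet_Ioi fun r hr => hnorm x r hr, integral_mul_const,
      Real.integral_rpow_mul_exp_neg_mul_Ioi (by positivity) hx, one_div, Real.inv_rpow hx.le,
      ← Real.rpow_neg hx.le, ← Real.rpow_natCast (1 + x ^ 2) n]
    have : (1 + x ^ 2) ^ (-(n + 1 / 2 : ℝ)) * (1 + x ^ 2) ^ (n : ℝ) = (1 + x ^ 2) ^ (-(1 / 2) : ℝ) := by
      rw [← Real.rpow_add hx]; congr 1; ring
    rw [← this]; ring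
  have hint : Integrable (Function.uncurry f) ((volume.restrict (Set.Ioi 0)).prod volume) := by
    rw [integrable_prod_iff' hmeas]
    constructor
    · refine Filter.Eventually.of_forall fun x => ?_
      simp only [Function.uncurry, hf]
      refine Integrable.mul_const ?_ _
      have hx : 0 < 1 + x ^ 2 := by positivity
      have hR : IntegrableOn (fun r : ℝ => r ^ ((n + 1 / 2 : ℝ) - 1) *
          Real.exp (-((1 + x ^ 2) * r))) (Set.Ioi 0) := by
        have := integrableOn_rpow_mul_exp_neg_mul_rpow (p := 1) (s := (n + 1 / 2 : ℝ) - 1)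
          (b := 1 + x ^ 2) (by linarith [(Nat.cast_nonneg n : (0 : ℝ) ≤ n)]) one_pos hx
        simpa only [Real.rpow_one, neg_mul] using this
      refine hR.mono' (Measurable.aestronglyMeasurable (by fun_prop)) ?_
      filter_upwards [ae_restrict_mem measurableSet_Ioi] with r hr
      have hr : 0 < r := hr
      rw [norm_mul, Complex.norm_cpow_eq_rpow_re_of_pos hr, Complex.sub_re, hsre, Complex.one_re,
        show -(((1 + x ^ 2 : ℝ) : ℂ) * r) = ((-((1 + x ^ 2) * r) : ℝ) : ℂ) by push_cast; ring,
        ← Complex.ofReal_exp, Complex.norm_real, Real.norm_of_nonneg (Real.exp_pos _).le]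
    · simp only [Function.uncurry_apply_pair, hgauss]
      refine Integrable.const_mul ?_ _
      refine (integrable_inv_one_add_sq.const_mul C).mono' ?_ (Filter.Eventually.of_forall fun x => ?_)
      · have := hF.measurable
        exact Measurable.aestronglyMeasurable (by fun_prop)
      · have hx : 0 < 1 + x ^ 2 := by positivity
        have hsq : 0 < Real.sqrt (1 + x ^ 2) := Real.sqrt_pos.mpr hx
        rw [Real.norm_of_nonneg (by positivity), Real.rpow_neg hx.le, ← Real.sqrt_eq_rpow,
          ← div_eq_mul_inv, le_div_iff₀ hx]
        refine le_trans (le_of_eq ?_) (hC x)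
        nth_rewrite 2 [← Real.sq_sqrt hx.le]
        field_simp
  have h1 : ∫ r in Set.Ioi (0 : ℝ), (r : ℂ) ^ (Complex.I * t + n - 1 / 2) * (Real.exp (-r) : ℂ) *
        ∫ x : ℝ, gaussWeight r 1 0 (2 * n) x * F x = ∫ r in Set.Ioi (0 : ℝ), ∫ x : ℝ, f r x := by
    simp only [← hfr, integral_const_mul]
  rw [h1, integral_integral_swap hint, ← integral_const_mul]
  congr 1; ext x
  simp only [hf]
  rw [integral_mul_const, Complex.integral_cpow_mul_exp_neg_mul_Ioi hspos (by positivity)]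
  ring

/-- Parseval-type evaluation of the pairing of a test function with the Kirillov kernel. -/
lemma integral_mul_integral_kirillovKernel (t : ℝ) (n : ℕ) {h : ℝ → ℂ} (hh : Integrable h)
    {δ R ε C : ℝ} (hδ : 0 < δ) (hb : ∀ u, h u ≠ 0 → δ ≤ |u| ∧ |u| ≤ R) (hε : ε ^ 2 = 1)
    (hF : Continuous (𝓕 h)) (hC : ∀ x, ‖𝓕 h x‖ * Real.sqrt (1 + x ^ 2) ≤ C) :
    ∫ u : ℝ, h u * ∫ r in Set.Ioi (0 : ℝ), kirillovKernel (Complex.I * t) n (ε * u) r =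
      Complex.Gamma (Complex.I * t + n + 1 / 2) *
        ∫ x : ℝ, (1 + Complex.I * x) ^ (2 * n) *
          (1 / ((1 + x ^ 2 : ℝ) : ℂ)) ^ (Complex.I * t + n + 1 / 2) * 𝓕 h (ε * x) := by
  rw [← integral_gaussWeight_mul t n (F := fun x => 𝓕 h (ε * x)) (by fun_prop) (C := C)
    fun x => by simpa [mul_pow, hε] using hC (ε * x)]
  simp only [← integral_const_mul]
  rw [integral_integral_swap (integrable_mul_kirillovKernel t n hh hδ hb hε)]
  refine setIntegral_congr_fun measurableSet_Ioi fun r hr => ?_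
  simp only [kirillovKernel]
  rw [integral_const_mul, ← integral_mul_gaussMoment hr 1 (2 * n) ε hh, ← integral_const_mul]
  congr 1; ext u
  ring

/-- Completeness of the powers of the Cayley transform on the real line. -/
lemma eq_zero_of_integral_cayley_eq_zero (t : ℝ) {F : ℝ → ℂ} (hF : Continuous F) {C : ℝ}
    (hC : ∀ x, ‖F x‖ * Real.sqrt (1 + x ^ 2) ≤ C)
    (h : ∀ (n : ℕ) (ε : ℝ), ε ^ 2 = 1 → ∫ x : ℝ, (1 + Complex.I * x) ^ (2 * n) *
      (1 / ((1 + x ^ 2 : ℝ) : ℂ)) ^ (Complex.I * t + n + 1 / 2) * F (ε * x) = 0) :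
    ∀ x, F x = 0 := by
  set U := Set.Ioo (-(Real.pi / 2)) (Real.pi / 2) with hU
  have hcos : ∀ θ ∈ U, 0 < Real.cos θ := fun θ hθ => Real.cos_pos_of_mem_Ioo hθ
  set ψ : ℝ → ℂ := fun θ => ((Real.cos θ ^ 2 : ℝ) : ℂ) ^ (Complex.I * t - 1 / 2) *
    F (Real.tan θ) with hψ
  have h' : ∀ (n : ℕ) (ε : ℝ), ε ^ 2 = 1 → ∫ x : ℝ, (1 + Complex.I * (ε * x)) ^ (2 * n) *
      (1 / ((1 + x ^ 2 : ℝ) : ℂ)) ^ (Complex.I * t + n + 1 / 2) * F x = 0 := by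
    intro n ε hε
    have hn := h n ε hε
    have hε' : ε = 1 ∨ ε = -1 := by simpa using hε
    rcases hε' with rfl | rfl
    · simpa using hn
    · rw [← integral_neg_eq_self] at hn
      simpa using hn
  have hexp : ∀ (n : ℕ) (ε : ℝ), ε ^ 2 = 1 →
      ∫ θ in U, Complex.exp (Complex.I * (2 * n * ε * θ)) * ψ θ = 0 := by
    intro n ε hε
    have hd : ∀ θ ∈ U, HasDerivWithinAt Real.tan (1 / Real.cos θ ^ 2) U θ := fun θ hθ =>
      (Real.hasDerivAt_tan (hcos θ hθ).ne').hasDerivWithinAt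
    have hs := integral_image_eq_integral_abs_deriv_smul measurableSet_Ioo hd Real.injOn_tan
      (fun x : ℝ => (1 + Complex.I * (ε * x)) ^ (2 * n) *
      (1 / ((1 + x ^ 2 : ℝ) : ℂ)) ^ (Complex.I * t + n + 1 / 2) * F x)
    rw [Real.image_tan_Ioo, setIntegral_univ, h' n ε hε] at hs
    rw [hs]
    refine setIntegral_congr_fun measurableSet_Ioo fun θ hθ => ?_
    have hc := hcos θ hθ
    have hcc : (Complex.cos θ) ≠ 0 := by rw [← Complex.ofReal_cos]; exact_mod_cast hc.ne'
    have hcc2 : ((Real.cos θ ^ 2 : ℝ) : ℂ) ≠ 0 := by exact_mod_cast (pow_pos hc 2).ne'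
    have e1 : (1 / ((1 + Real.tan θ ^ 2 : ℝ) : ℂ)) = ((Real.cos θ ^ 2 : ℝ) : ℂ) := by
      rw [← Real.inv_one_add_tan_sq hc.ne']; push_cast; rw [one_div]
    have e2 : ((Real.cos θ ^ 2 : ℝ) : ℂ) ^ (Complex.I * t + n + 1 / 2) =
        ((Real.cos θ ^ 2 : ℝ) : ℂ) ^ (Complex.I * t - 1 / 2) * ((Real.cos θ ^ 2 : ℝ) : ℂ) ^ n *
          ((Real.cos θ ^ 2 : ℝ) : ℂ) := by
      rw [show Complex.I * t + n + 1 / 2 = (Complex.I * t - 1 / 2) + n + 1 by ring,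
        Complex.cpow_add _ _ hcc2, Complex.cpow_add _ _ hcc2, Complex.cpow_one,
        Complex.cpow_natCast]
    have e3 : Complex.exp (Complex.I * (2 * n * ε * θ)) =
        (1 + Complex.I * (ε * (Real.tan θ : ℂ))) ^ (2 * n) * ((Real.cos θ ^ 2 : ℝ) : ℂ) ^ n := by
      have : Complex.exp (ε * θ * Complex.I) =
          (1 + Complex.I * (ε * (Real.tan θ : ℂ))) * Complex.cos θ := by
        rw [Complex.exp_mul_I, Complex.ofReal_tan, Complex.tan_eq_sin_div_cos]
        have hε' : ε = 1 ∨ ε = -1 := by simpa using hε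
        rcases hε' with rfl | rfl
        · simp; field_simp
        · simp; field_simp
      rw [show Complex.I * (2 * n * ε * θ) = ((2 * n : ℕ) : ℂ) * (ε * θ * Complex.I) by
        push_cast; ring, Complex.exp_nat_mul, this, mul_pow, pow_mul (Complex.cos θ)]
      push_cast
      ring
    simp only [hψ]
    rw [e1, e2, e3, abs_of_pos (by positivity), Complex.real_smul]
    push_cast at hcc2 ⊢
    field_simp
  have hab : -(Real.pi / 2) < Real.pi / 2 := by linarith [Real.pi_pos]
  have hψcont : ContinuousOn ψ U := by
    refine ContinuousOn.mul (ContinuousOn.cpow_const (by fun_prop) fun θ hθ => ?_)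
      (hF.comp_continuousOn Real.continuousOn_tan_Ioo)
    exact Complex.ofReal_mem_slitPlane.mpr (pow_pos (hcos θ hθ) 2)
  have hψbound : ∀ θ ∈ U, ‖ψ θ‖ ≤ C := by
    intro θ hθ
    have hc := hcos θ hθ
    refine le_trans (le_of_eq ?_) (hC (Real.tan θ))
    have e : Real.sqrt (1 + Real.tan θ ^ 2) = (Real.cos θ ^ 2) ^ (-(1 / 2) : ℝ) := by
      rw [← Real.inv_one_add_tan_sq hc.ne', Real.inv_rpow (by positivity), Real.rpow_neg (by positivity),
        inv_inv, Real.sqrt_eq_rpow]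
    simp only [hψ]
    rw [norm_mul, Complex.norm_cpow_eq_rpow_re_of_pos (pow_pos hc 2), e, mul_comm]
    simp
  have hres : volume.restrict U = volume.restrict (Set.Ioc (-(Real.pi / 2)) (Real.pi / 2)) :=
    Measure.restrict_congr_set Ioo_ae_eq_Ioc
  have hmem : MemLp ψ 2 (volume.restrict (Set.Ioc (-(Real.pi / 2)) (Real.pi / 2))) := by
    rw [← hres]
    have : IsFiniteMeasure (volume.restrict U) := ⟨by simp [hU]⟩
    refine MemLp.of_bound (hψcont.aestronglyMeasurable measurableSet_Ioo) C ?_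
    filter_upwards [ae_restrict_mem measurableSet_Ioo] with θ hθ using hψbound θ hθ
  have hcoef : ∀ m : ℤ, fourierCoeffOn hab ψ m = 0 := by
    intro m
    rw [fourierCoeffOn_eq_integral, intervalIntegral.integral_of_le hab.le, ← hres]
    obtain ⟨ε, hε, hm⟩ : ∃ ε : ℝ, ε ^ 2 = 1 ∧ ε * m.natAbs = -m := by
      rcases le_total 0 m with hm | hm
      · exact ⟨-1, by norm_num, by rw [Nat.cast_natAbs, abs_of_nonneg hm]; simp⟩
      · exact ⟨1, by norm_num, by rw [Nat.cast_natAbs, abs_of_nonpos hm]; simp⟩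
    have hm' : (ε : ℂ) * (m.natAbs : ℂ) = -(m : ℂ) := by exact_mod_cast congrArg Complex.ofReal hm
    rw [smul_eq_zero]
    right
    rw [← hexp m.natAbs ε hε]
    congr 1; ext θ
    rw [fourier_coe_apply, smul_eq_mul]
    congr 2
    have hπ : (Real.pi : ℂ) ≠ 0 := by exact_mod_cast Real.pi_ne_zero
    rw [show Complex.I * (2 * (m.natAbs : ℂ) * ε * θ) = Complex.I * (2 * (ε * (m.natAbs : ℂ)) * θ) by
      ring, hm']
    push_cast
    field_simp
    ring
  have hsum := hasSum_sq_fourierCoeffOn hab hmem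
  simp only [hcoef, norm_zero, ne_eq, OfNat.ofNat_ne_zero, not_false_eq_true, zero_pow] at hsum
  have hzero : ∫ θ in U, ‖ψ θ‖ ^ 2 = 0 := by
    have h0 := hsum.unique hasSum_zero
    rw [smul_eq_zero, intervalIntegral.integral_of_le hab.le, ← hres] at h0
    refine h0.resolve_left (inv_ne_zero ?_)
    linarith [Real.pi_pos]
  have hae : ψ =ᵐ[volume.restrict U] fun _ => (0 : ℂ) := by
    rw [integral_eq_zero_iff_of_nonneg (fun θ => by positivity)
      (by rw [← hres] at hmem; exact hmem.norm.integrable_sq)] at hzero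
    filter_upwards [hzero] with θ hθ
    simpa using hθ
  have hzero' := Measure.eqOn_open_of_ae_eq hae isOpen_Ioo hψcont continuousOn_const
  intro x
  have hx := hzero' (Real.arctan_mem_Ioo x)
  simp only [hψ, Real.tan_arctan] at hx
  refine (mul_eq_zero.mp hx).resolve_left ?_
  rw [Complex.cpow_eq_zero_iff]
  have hc := Real.cos_arctan_pos x
  have : ((Real.cos (Real.arctan x) ^ 2 : ℝ) : ℂ) ≠ 0 := by exact_mod_cast (pow_pos hc 2).ne'
  exact fun h => this h.1

lemma exists_bounds_of_hasCompactSupport {g : ℝ → ℂ} (hcompact : HasCompactSupport g)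
    (hsupp : tsupport g ⊆ {(0 : ℝ)}ᶜ) :
    ∃ δ R : ℝ, 0 < δ ∧ ∀ u, g u ≠ 0 → δ ≤ |u| ∧ |u| ≤ R := by
  have h0 : (0 : ℝ) ∈ (tsupport g)ᶜ := fun h => hsupp h rfl
  obtain ⟨δ, hδ, hb⟩ := Metric.isOpen_iff.mp (isClosed_tsupport g).isOpen_compl 0 h0
  obtain ⟨R, hR⟩ := hcompact.isCompact.isBounded.subset_closedBall 0
  refine ⟨δ, R, hδ, fun u hu => ?_⟩
  have hu' := subset_tsupport g hu
  constructor
  · by_contra! hlt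
    exact hb (by simpa using hlt) hu'
  · simpa using hR hu'

lemma contDiff_conj_mul_exp_log {g : ℝ → ℂ} (hsmooth : ContDiff ℝ (⊤ : ℕ∞) g)
    (hsupp : tsupport g ⊆ {(0 : ℝ)}ᶜ) (c : ℂ) :
    ContDiff ℝ (⊤ : ℕ∞) fun u : ℝ => (starRingEnd ℂ) (g u) * Complex.exp (c * Real.log u) := by
  rw [contDiff_iff_contDiffAt]
  intro u
  by_cases hu : u ∈ tsupport g
  · have hu0 : u ≠ 0 := hsupp hu
    have h1 : ContDiffAt ℝ (⊤ : ℕ∞) (fun u => (starRingEnd ℂ) (g u)) u :=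
      (Complex.conjCLE.contDiff.comp hsmooth).contDiffAt
    have h2 : ContDiffAt ℝ (⊤ : ℕ∞) (fun u : ℝ => ((Real.log u : ℝ) : ℂ)) u :=
      Complex.ofRealCLM.contDiff.contDiffAt.comp u (Real.contDiffAt_log.mpr hu0)
    exact h1.mul (contDiffAt_const.mul h2).cexp
  · refine (contDiffAt_const (c := (0 : ℂ))).congr_of_eventuallyEq ?_
    filter_upwards [notMem_tsupport_iff_eventuallyEq.mp hu] with v hv
    simp [hv]

lemma SchwartzMap.exists_norm_mul_sqrt_le (S : SchwartzMap ℝ ℂ) :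
    ∃ C, ∀ x, ‖S x‖ * Real.sqrt (1 + x ^ 2) ≤ C := by
  obtain ⟨C₀, -, h₀⟩ := S.decay 0 0
  obtain ⟨C₁, -, h₁⟩ := S.decay 1 0
  refine ⟨C₀ + C₁, fun x => ?_⟩
  have hs : Real.sqrt (1 + x ^ 2) ≤ 1 + |x| := by
    rw [Real.sqrt_le_left (by positivity)]
    nlinarith [sq_abs x, abs_nonneg x]
  have := h₀ x
  have := h₁ x
  simp only [norm_iteratedFDeriv_zero, pow_zero, pow_one, one_mul, Real.norm_eq_abs] at *
  nlinarith [mul_le_mul_of_nonneg_left hs (norm_nonneg (S x))]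

/-- Completeness of the Kirillov vectors in the unitary principal series. -/
theorem kirillov_completeness (t : ℝ) (g : ℝ → ℂ) (hsmooth : ContDiff ℝ (⊤ : ℕ∞) g)
    (hcompact : HasCompactSupport g) (hsupp : tsupport g ⊆ {(0 : ℝ)}ᶜ)
    (horth : ∀ ℓ : ℤ,
      (∫ u in ({(0 : ℝ)}ᶜ : Set ℝ),
        g u * (starRingEnd ℂ) (Kvec ℓ (Complex.I * (t : ℂ)) u) / ((|u| : ℝ) : ℂ)) = 0) :
    ∀ u : ℝ, g u = 0 := by
  set ν : ℂ := Complex.I * t with hν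
  set h : ℝ → ℂ := fun u => (starRingEnd ℂ) (g u) * Complex.exp (-(1 / 2 + ν) * Real.log u) with hh
  have hcd : ContDiff ℝ (⊤ : ℕ∞) h := contDiff_conj_mul_exp_log hsmooth hsupp _
  have hzero : ∀ u, g u = 0 → h u = 0 := fun u hu => by simp [hh, hu]
  have hcs : HasCompactSupport h := by
    refine hcompact.mono fun u hu => ?_
    exact fun hg => hu (hzero u hg)
  obtain ⟨δ, R, hδ, hb⟩ := exists_bounds_of_hasCompactSupport hcompact hsupp
  have hb' : ∀ u, h u ≠ 0 → δ ≤ |u| ∧ |u| ≤ R := fun u hu => hb u fun hg => hu (hzero u hg)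
  set S : SchwartzMap ℝ ℂ := hcs.toSchwartzMap hcd with hS
  have hSh : (S : ℝ → ℂ) = h := rfl
  have hFS : ((𝓕 S : SchwartzMap ℝ ℂ) : ℝ → ℂ) = 𝓕 h := rfl
  have hF : Continuous (𝓕 h) := hFS ▸ (𝓕 S : SchwartzMap ℝ ℂ).continuous
  obtain ⟨C, hC⟩ := (𝓕 S : SchwartzMap ℝ ℂ).exists_norm_mul_sqrt_le
  rw [hFS] at hC
  have hhint : Integrable h := hcd.continuous.integrable_of_hasCompactSupport hcs
  have hg0 : g 0 = 0 := by
    by_contra h0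
    exact hsupp (subset_tsupport g h0) rfl
  have hpair : ∀ (n : ℕ) (ε : ℝ), ε ^ 2 = 1 → ∫ x : ℝ, (1 + Complex.I * x) ^ (2 * n) *
      (1 / ((1 + x ^ 2 : ℝ) : ℂ)) ^ (Complex.I * t + n + 1 / 2) * 𝓕 h (ε * x) = 0 := by
    intro n ε hε
    obtain ⟨ℓ, hℓ, hεℓ⟩ : ∃ ℓ : ℤ, ℓ.natAbs = n ∧ ε * n = ℓ := by
      have hε' : ε = 1 ∨ ε = -1 := by simpa using hε
      rcases hε' with rfl | rfl
      · exact ⟨n, by simp, by simp⟩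
      · exact ⟨-n, by simp, by simp⟩
    subst hℓ
    set n := ℓ.natAbs
    have hΓ : Complex.Gamma (ν + n + 1 / 2) ≠ 0 := by
      refine Complex.Gamma_ne_zero_of_re_pos ?_
      simp only [hν, Complex.add_re, Complex.mul_re, Complex.I_re, Complex.I_im, Complex.ofReal_re,
        Complex.ofReal_im, Complex.natCast_re]
      norm_num
      positivity
    have hK := integral_mul_integral_kirillovKernel t n hhint hδ hb' hε hF hC
    have horth' := congrArg (starRingEnd ℂ) (horth ℓ)
    rw [← integral_conj, map_zero] at horth'
    have hpt : ∀ u ∈ ({(0 : ℝ)}ᶜ : Set ℝ),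
        (starRingEnd ℂ) (g u * (starRingEnd ℂ) (Kvec ℓ ν u) / ((|u| : ℝ) : ℂ)) =
          (-1) ^ n / Complex.Gamma (ν + n + 1 / 2) *
            (h u * ∫ r in Set.Ioi (0 : ℝ), kirillovKernel ν n (ε * u) r) := by
      intro u hu
      have hu0 : u ≠ 0 := hu
      have huc : ((|u| : ℝ) : ℂ) ≠ 0 := by exact_mod_cast (abs_pos.mpr hu0).ne'
      rw [map_div₀, map_mul, Complex.conj_conj, Complex.conj_ofReal,
        Kvec_eq_integral_kirillovKernel ℓ t hu0 hε hεℓ]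
      have e : Complex.exp (-(1 / 2 + ν) * Real.log u) * ((|u| : ℝ) : ℂ) =
          ((|u| : ℝ) : ℂ) ^ (1 / 2 - ν) := by
        have : Complex.exp (-(1 / 2 + ν) * Real.log u) = ((|u| : ℝ) : ℂ) ^ (-(1 / 2 + ν)) := by
          rw [Complex.cpow_def_of_ne_zero huc, ← Complex.ofReal_log (abs_nonneg u), Real.log_abs,
            mul_comm]
        rw [this]
        nth_rewrite 2 [← Complex.cpow_one ((|u| : ℝ) : ℂ)]
        rw [← Complex.cpow_add _ _ huc]
        congr 1; ring
      rw [← hν, ← e]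
      simp only [hh]
      change _ = (-1) ^ ℓ.natAbs / Complex.Gamma (ν + (ℓ.natAbs : ℂ) + 1 / 2) * (_ *
        ∫ r in Set.Ioi (0 : ℝ), kirillovKernel ν ℓ.natAbs (ε * u) r)
      rw [div_eq_iff huc]
      ring
    rw [setIntegral_congr_fun (measurableSet_singleton 0).compl hpt,
      setIntegral_eq_integral_of_forall_compl_eq_zero, integral_const_mul, hK] at horth'
    · have hne : (-1) ^ n / Complex.Gamma (ν + n + 1 / 2) ≠ 0 :=
        div_ne_zero (pow_ne_zero _ (by norm_num)) hΓ
      exact (mul_eq_zero.mp ((mul_eq_zero.mp horth').resolve_left hne)).resolve_left hΓ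
    · intro u hu
      have : u = 0 := by simpa using hu
      rw [this, hzero 0 hg0]
      simp
  have hF0 := eq_zero_of_integral_cayley_eq_zero t hF hC hpair
  have hS0 : S = 0 := by
    have : (𝓕 S : SchwartzMap ℝ ℂ) = 0 := by
      ext x
      rw [hFS, hF0 x]
      rfl
    exact (FourierTransform.fourierCLE ℂ (SchwartzMap ℝ ℂ)).map_eq_zero_iff.mp this
  intro u
  have hu : h u = 0 := by rw [← hSh, hS0]; rfl
  simpa [hh] using hu
end

section
/- Orthogonality and norm of discrete-series Whittaker functions: let l ≥ 1 be an integer and ℓ, ℓ′ integers with ℓ ≥ l and ℓ′ ≥ l. Then ∫₀^{∞} W_{ℓ, l−1/2}(y) · W_{ℓ′, l−1/2}(y) · dy/y equals Γ(ℓ−l+1)·Γ(ℓ+l) if ℓ = ℓ′ and equals 0 if ℓ ≠ ℓ′; the integral converges absolutely. -/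
open MeasureTheory

/-- The Whittaker function W_{μ,ν}(y), defined for Re ν > 0, μ + ν + 1/2 not a nonpositive
integer and y > 0 by the absolutely convergent integral
W_{μ,ν}(y) = e^{iπμ} Γ(μ+ν+1/2) π^{−1} (y/4)^{1/2−ν}
  ∫ e^{−iyξ/2} (ξ²+1)^{−ν−1/2} exp(μ(Log(ξ−i) − Log(ξ+i))) dξ. -/
noncomputable def Wh (μ ν : ℂ) (y : ℝ) : ℂ :=
  Complex.exp (Complex.I * (Real.pi : ℂ) * μ) * Complex.Gamma (μ + ν + 1 / 2) / (Real.pi : ℂ) *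
    ((y / 4 : ℝ) : ℂ) ^ ((1 : ℂ) / 2 - ν) *
    ∫ ξ : ℝ,
      Complex.exp (-Complex.I * (y : ℂ) * (ξ : ℂ) / 2) *
        ((ξ ^ 2 + 1 : ℝ) : ℂ) ^ (-ν - 1 / 2) *
        Complex.exp (μ * (Complex.log ((ξ : ℂ) - Complex.I) - Complex.log ((ξ : ℂ) + Complex.I)))

theorem integrableOn_pow_mul_cexp_neg_mul_Ioi {z : ℂ} (hz : 0 < z.re) (n : ℕ) :
    IntegrableOn (fun t : ℝ => (t : ℂ) ^ n * Complex.exp (-(z * t))) (Set.Ioi 0) := by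
  have h := integrableOn_rpow_mul_exp_neg_mul_rpow (p := 1) (s := n) (b := z.re)
    (by have : (0 : ℝ) ≤ n := n.cast_nonneg
        linarith) one_pos hz
  refine Integrable.mono' h (by fun_prop) ?_
  refine (ae_restrict_iff' measurableSet_Ioi).mpr (ae_of_all _ fun t ht => le_of_eq ?_)
  have ht0 : (0 : ℝ) < t := ht
  simp [Complex.norm_exp, abs_of_pos ht0]

theorem integral_pow_mul_cexp_neg_mul_Ioi {z : ℂ} (hz : 0 < z.re) (n : ℕ) :
    ∫ t : ℝ in Set.Ioi 0, (t : ℂ) ^ n * Complex.exp (-(z * t)) = n.factorial / z ^ (n + 1) := by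
  have hz0 : z ≠ 0 := by rintro rfl; simp at hz
  induction n with
  | zero =>
    have := integral_exp_mul_complex_Ioi (a := -z) (by simpa using hz) 0
    simpa [neg_mul] using this
  | succ n ih =>
    have hv : ∀ x : ℝ, HasDerivAt (fun t : ℝ => -Complex.exp (-(z * t)) / z)
        (Complex.exp (-(z * x))) x := fun x => by
      have h1 : HasDerivAt (fun t : ℝ => -(z * (t : ℂ))) (-(z * 1)) x :=
        ((Complex.ofRealCLM.hasDerivAt (x := x)).const_mul z).neg
      convert! (h1.cexp.neg.div_const z) using 1
      field_simp
    have hu : ∀ x : ℝ, HasDerivAt (fun t : ℝ => (t : ℂ) ^ (n + 1))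
        ((n + 1 : ℕ) * (x : ℂ) ^ n) x := fun x => by
      simpa using (Complex.ofRealCLM.hasDerivAt (x := x)).fun_pow (n + 1)
    have hlim : Filter.Tendsto
        (fun t : ℝ => (t : ℂ) ^ (n + 1) * (-Complex.exp (-(z * t)) / z)) Filter.atTop (nhds 0) := by
      rw [tendsto_zero_iff_norm_tendsto_zero]
      have h := (tendsto_rpow_mul_exp_neg_mul_atTop_nhds_zero (n + 1 : ℕ) z.re hz).mul_const ‖z‖⁻¹
      rw [zero_mul] at h
      refine h.congr' ?_
      filter_upwards [Filter.eventually_gt_atTop 0] with t ht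
      rw [Real.rpow_natCast]
      simp [Complex.norm_exp, abs_of_pos ht, div_eq_mul_inv, mul_assoc]
    have hzero : Filter.Tendsto
        (fun t : ℝ => (t : ℂ) ^ (n + 1) * (-Complex.exp (-(z * t)) / z))
        (nhdsWithin 0 (Set.Ioi 0)) (nhds 0) := by
      have : Continuous (fun t : ℝ => (t : ℂ) ^ (n + 1) * (-Complex.exp (-(z * t)) / z)) := by
        fun_prop
      simpa using (this.tendsto 0).mono_left nhdsWithin_le_nhds
    have hint : IntegrableOn (fun t : ℝ => ((n + 1 : ℕ) * (t : ℂ) ^ n) *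
        (-Complex.exp (-(z * t)) / z)) (Set.Ioi 0) := by
      refine ((integrableOn_pow_mul_cexp_neg_mul_Ioi hz n).const_mul (-(n + 1 : ℕ) / z)).congr
        (ae_of_all _ fun t => ?_)
      ring
    rw [integral_Ioi_mul_deriv_eq_deriv_mul (fun x _ => hu x) (fun x _ => hv x)
      (integrableOn_pow_mul_cexp_neg_mul_Ioi hz (n + 1)) hint hzero hlim]
    have : ∀ t : ℝ, ((n + 1 : ℕ) * (t : ℂ) ^ n) * (-Complex.exp (-(z * t)) / z) =
        (-(n + 1 : ℕ) / z) * ((t : ℂ) ^ n * Complex.exp (-(z * t))) := fun t => by ring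
    simp_rw [this]
    rw [integral_const_mul, ih, Nat.factorial_succ]
    push_cast
    field_simp
    ring

theorem ofReal_add_I_ne_zero (x : ℝ) : (x + Complex.I : ℂ) ≠ 0 := by
  intro h
  have := congrArg Complex.im h
  simp at this

theorem one_add_sq_le_norm_add_I_pow (x : ℝ) (n : ℕ) :
    1 + x ^ 2 ≤ ‖(x + Complex.I : ℂ)‖ ^ (n + 2) := by
  have h2 : ‖(x + Complex.I : ℂ)‖ ^ 2 = 1 + x ^ 2 := by
    rw [← Complex.normSq_eq_norm_sq, Complex.normSq_apply]
    simp
    ring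
  have h1 : 1 ≤ ‖(x + Complex.I : ℂ)‖ := by
    nlinarith [sq_nonneg x, norm_nonneg (x + Complex.I : ℂ)]
  exact h2.symm.le.trans (pow_le_pow_right₀ h1 (by omega))

theorem integrable_cexp_div_add_I_pow (t : ℝ) (n : ℕ) :
    Integrable (fun x : ℝ => Complex.exp (-Complex.I * t * x) / (x + Complex.I) ^ (n + 2)) := by
  refine integrable_inv_one_add_sq.mono' ?_ (ae_of_all _ fun x => ?_)
  · exact (Continuous.div (by fun_prop) (by fun_prop)
      fun x => pow_ne_zero _ (ofReal_add_I_ne_zero x)).aestronglyMeasurable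
  · have h : ‖Complex.exp (-Complex.I * t * x)‖ = 1 := by simp [Complex.norm_exp]
    rw [norm_div, h, norm_pow, one_div]
    exact inv_anti₀ (by positivity) (one_add_sq_le_norm_add_I_pow x n)

theorem one_add_two_pi_mul_I_eq (w : ℝ) : (1 + 2 * Real.pi * w * Complex.I : ℂ) =
    -Complex.I * (((-(2 * Real.pi) * w : ℝ) : ℂ) + Complex.I) := by
  push_cast
  linear_combination Complex.I_sq

theorem integrable_inv_one_add_two_pi_mul_I_pow (n : ℕ) :
    Integrable (fun w : ℝ => ((1 + 2 * Real.pi * w * Complex.I : ℂ) ^ (n + 2))⁻¹) := by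
  have h := ((integrable_cexp_div_add_I_pow 0 n).comp_mul_left'
    (R := -(2 * Real.pi)) (by simp [Real.pi_ne_zero])).const_mul ((-Complex.I) ^ (n + 2))⁻¹
  refine h.congr (ae_of_all _ fun w => ?_)
  simp only [Complex.ofReal_zero, mul_zero, zero_mul, Complex.exp_zero, one_div]
  rw [one_add_two_pi_mul_I_eq, mul_pow, mul_inv]

open FourierTransform in
theorem integral_cexp_div_add_I_pow {t : ℝ} (ht : 0 < t) (n : ℕ) :
    ∫ ξ : ℝ, Complex.exp (-Complex.I * t * ξ) / (ξ + Complex.I) ^ (n + 2) =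
      2 * Real.pi * (-Complex.I) ^ (n + 2) * t ^ (n + 1) * Complex.exp (-t) /
        (n + 1).factorial := by
  set f : ℝ → ℂ := fun t => ((max t 0 : ℝ) : ℂ) ^ (n + 1) * Complex.exp (-t) with hf
  have hcont : Continuous f := by fun_prop
  have hind : ∀ g : ℝ → ℂ, (fun x => g x * f x) =
      (Set.Ioi (0 : ℝ)).indicator fun x => g x * ((x : ℂ) ^ (n + 1) * Complex.exp (-x)) := by
    intro g
    ext x
    by_cases hx : 0 < x
    · simp [hf, hx, max_eq_left hx.le]
    · simp [hf, hx, max_eq_right (not_lt.mp hx)]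
  have hfint : Integrable f := by
    have h1 := hind fun _ => 1
    simp only [one_mul] at h1
    rw [show f = fun x => f x from rfl, h1, integrable_indicator_iff measurableSet_Ioi]
    simpa using integrableOn_pow_mul_cexp_neg_mul_Ioi (z := 1) (by simp) (n + 1)
  have hF : 𝓕 f = fun w : ℝ => ((n + 1).factorial : ℂ) *
      ((1 + 2 * Real.pi * w * Complex.I : ℂ) ^ (n + 2))⁻¹ := by
    ext w
    rw [Real.fourier_real_eq_integral_exp_smul]
    simp_rw [smul_eq_mul]
    rw [hind, integral_indicator measurableSet_Ioi, ← div_eq_mul_inv,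
      ← integral_pow_mul_cexp_neg_mul_Ioi (by simp)]
    refine integral_congr_ae (ae_of_all _ fun x => ?_)
    simp only
    rw [mul_left_comm, ← Complex.exp_add]
    congr 2
    push_cast
    ring
  have hinv := hfint.fourierInv_fourier_eq (v := t)
    (by rw [hF]; exact (integrable_inv_one_add_two_pi_mul_I_pow n).const_mul _) hcont.continuousAt
  rw [hF, Real.fourierInv_eq'] at hinv
  have hcv := Measure.integral_comp_mul_left
    (fun ξ : ℝ => Complex.exp (-Complex.I * t * ξ) / (ξ + Complex.I) ^ (n + 2)) (-(2 * Real.pi))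
  have hpt : ∀ v : ℝ, Complex.exp (-Complex.I * t * ((-(2 * Real.pi) * v : ℝ) : ℂ)) /
      (((-(2 * Real.pi) * v : ℝ) : ℂ) + Complex.I) ^ (n + 2) =
      ((-Complex.I) ^ (n + 2) / (n + 1).factorial) *
      (Complex.exp (((2 * Real.pi * inner ℝ v t : ℝ) : ℂ) * Complex.I) •
        (((n + 1).factorial : ℂ) * ((1 + 2 * Real.pi * v * Complex.I : ℂ) ^ (n + 2))⁻¹)) := by
    intro v
    have h3 : ((n + 1).factorial : ℂ) ≠ 0 := by exact_mod_cast (n + 1).factorial_ne_zero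
    have h4 : (-Complex.I : ℂ) ^ (n + 2) ≠ 0 := pow_ne_zero _ (by simp)
    have h5 : (((-(2 * Real.pi) * v : ℝ) : ℂ) + Complex.I) ^ (n + 2) ≠ 0 := pow_ne_zero _ (ofReal_add_I_ne_zero _)
    have h6 : -Complex.I * t * ((-(2 * Real.pi) * v : ℝ) : ℂ) =
        ((2 * Real.pi * inner ℝ v t : ℝ) : ℂ) * Complex.I := by
      simp
      ring
    rw [one_add_two_pi_mul_I_eq, mul_pow, h6, smul_eq_mul]
    generalize (((-(2 * Real.pi) * v : ℝ) : ℂ) + Complex.I) ^ (n + 2) = A at *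
    field_simp
  simp_rw [hpt] at hcv
  rw [integral_const_mul, hinv] at hcv
  have habs : |(-(2 * Real.pi))⁻¹| = (2 * Real.pi)⁻¹ := by
    rw [inv_neg, abs_neg, abs_of_pos (by positivity)]
  have hpi : (Real.pi : ℂ) ≠ 0 := by exact_mod_cast Real.pi_ne_zero
  rw [habs, Complex.real_smul] at hcv
  simp only [hf, max_eq_left ht.le] at hcv
  push_cast at hcv
  rw [← mul_right_inj' (inv_ne_zero (mul_ne_zero two_ne_zero hpi)), ← hcv]
  field_simp

theorem sum_alternating_choose_mul_eval {R : Type*} [CommRing R] (n : ℕ) (P : Polynomial R) :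
    ∑ k ∈ Finset.range (n + 1), (-1 : R) ^ k * n.choose k * P.eval (k : R) =
      (-1) ^ n * (fwdDiff 1)^[n] P.eval 0 := by
  rw [fwdDiff_iter_eq_sum_shift, Finset.mul_sum]
  refine Finset.sum_congr rfl fun k hk => ?_
  obtain ⟨m, rfl⟩ := Nat.exists_eq_add_of_le (Nat.lt_succ_iff.mp (Finset.mem_range.mp hk))
  have h : ((-1 : R) ^ m) * (-1) ^ m = 1 := by rw [← mul_pow]; simp
  simp only [Nat.add_sub_cancel_left, zero_add, nsmul_eq_mul, mul_one, zsmul_eq_mul]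
  push_cast
  rw [pow_add]
  linear_combination (-(-1 : R) ^ k * (k + m).choose k * P.eval (k : R)) * h

theorem sum_alternating_choose_mul_factorial_div (n a j : ℕ) (hj : j ≤ n) :
    ∑ k ∈ Finset.range (n + 1), (-1 : ℂ) ^ k * n.choose k *
        ((a + k + j).factorial / (a + k).factorial) =
      if j = n then (-1 : ℂ) ^ n * n.factorial else 0 := by
  set P : Polynomial ℂ := (ascPochhammer ℂ j).comp (Polynomial.X + Polynomial.C (a + 1 : ℂ))
  have hdeg : P.natDegree = j := by
    rw [Polynomial.natDegree_comp, ascPochhammer_natDegree, Polynomial.natDegree_X_add_C, mul_one]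
  have hmon : P.Monic := (monic_ascPochhammer ℂ j).comp_X_add_C _
  have heval : ∀ k : ℕ, ((a + k + j).factorial / (a + k).factorial : ℂ) = P.eval (k : ℂ) := by
    intro k
    have h := factorial_mul_ascPochhammer ℂ (a + k) j
    have h0 : ((a + k).factorial : ℂ) ≠ 0 := by exact_mod_cast (a + k).factorial_ne_zero
    rw [← h, mul_div_cancel_left₀ _ h0]
    simp only [P, Polynomial.eval_comp, Polynomial.eval_add, Polynomial.eval_X, Polynomial.eval_C]
    push_cast
    ring_nf
  simp_rw [heval]
  rw [sum_alternating_choose_mul_eval]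
  split_ifs with h
  · have h2 := P.fwdDiff_iter_degree_eq_factorial
    rw [hdeg, hmon.leadingCoeff, one_smul, h] at h2
    rw [h2]
    simp
  · rw [Polynomial.fwdDiff_iter_eq_zero_of_degree_lt (by omega)]
    simp

/-- The polynomial `n! L_n^{(a)}(x)`, with `L_n^{(a)}` the generalized Laguerre polynomial. -/
noncomputable def laguerreSum (n a : ℕ) (x : ℂ) : ℂ :=
  ∑ k ∈ Finset.range (n + 1),
    (-1) ^ k * n.choose k * ((n + a).factorial / (a + k).factorial) * x ^ k

theorem sum_alternating_choose_mul_moment (m n a : ℕ) (hmn : m ≤ n) :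
    ∑ j ∈ Finset.range (m + 1), ∑ k ∈ Finset.range (n + 1),
      ((-1 : ℂ) ^ j * m.choose j * ((m + a).factorial / (a + j).factorial)) *
      ((-1) ^ k * n.choose k * ((n + a).factorial / (a + k).factorial)) *
      (a + j + k).factorial =
      if m = n then (n.factorial : ℂ) * (n + a).factorial else 0 := by
  have h : ∀ j ∈ Finset.range (m + 1), ∑ k ∈ Finset.range (n + 1),
      ((-1 : ℂ) ^ j * m.choose j * ((m + a).factorial / (a + j).factorial)) *
      ((-1) ^ k * n.choose k * ((n + a).factorial / (a + k).factorial)) *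
      (a + j + k).factorial =
      ((-1 : ℂ) ^ j * m.choose j * ((m + a).factorial / (a + j).factorial)) * (n + a).factorial *
        if j = n then (-1 : ℂ) ^ n * n.factorial else 0 := by
    intro j hj
    rw [← sum_alternating_choose_mul_factorial_div n a j
      ((Nat.lt_succ_iff.mp (Finset.mem_range.mp hj)).trans hmn), Finset.mul_sum]
    refine Finset.sum_congr rfl fun k _ => ?_
    rw [add_right_comm a j k]
    ring
  rw [Finset.sum_congr rfl h]
  split_ifs with hm
  · subst hm
    have h1 : ((-1 : ℂ) ^ m) * (-1) ^ m = 1 := by rw [← mul_pow]; simp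
    have h0 : ((m + a).factorial : ℂ) ≠ 0 := by exact_mod_cast (m + a).factorial_ne_zero
    simp only [mul_ite, mul_zero, Finset.sum_ite_eq', Finset.mem_range, Nat.lt_succ_self, if_true,
      Nat.choose_self, Nat.cast_one, mul_one]
    rw [add_comm a m, div_self h0]
    linear_combination (m + a).factorial * m.factorial * h1
  · refine Finset.sum_eq_zero fun j hj => ?_
    rw [if_neg (by have := Finset.mem_range.mp hj; omega), mul_zero]

theorem laguerreSum_mul_eq (m n a : ℕ) (x : ℝ) :
    (x : ℂ) ^ a * Complex.exp (-x) * laguerreSum m a x * laguerreSum n a x =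
      ∑ j ∈ Finset.range (m + 1), ∑ k ∈ Finset.range (n + 1),
      ((-1 : ℂ) ^ j * m.choose j * ((m + a).factorial / (a + j).factorial)) *
      ((-1) ^ k * n.choose k * ((n + a).factorial / (a + k).factorial)) *
      ((x : ℂ) ^ (a + j + k) * Complex.exp (-(1 * x))) := by
  rw [laguerreSum, laguerreSum, mul_assoc, Finset.sum_mul_sum, Finset.mul_sum]
  refine Finset.sum_congr rfl fun j _ => ?_
  rw [Finset.mul_sum]
  refine Finset.sum_congr rfl fun k _ => ?_
  rw [one_mul]
  ring

theorem integrableOn_laguerreSum_mul (m n a : ℕ) :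
    IntegrableOn (fun x : ℝ =>
      (x : ℂ) ^ a * Complex.exp (-x) * laguerreSum m a x * laguerreSum n a x) (Set.Ioi 0) := by
  simp_rw [laguerreSum_mul_eq]
  exact integrable_finsetSum _ fun j _ => integrable_finsetSum _ fun k _ =>
    (integrableOn_pow_mul_cexp_neg_mul_Ioi (by simp) _).const_mul _

theorem integral_laguerreSum_mul (m n a : ℕ) :
    ∫ x : ℝ in Set.Ioi 0,
      (x : ℂ) ^ a * Complex.exp (-x) * laguerreSum m a x * laguerreSum n a x =
      if m = n then (n.factorial : ℂ) * (n + a).factorial else 0 := by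
  wlog hmn : m ≤ n generalizing m n
  · have h := this n m (by omega)
    simp_rw [mul_right_comm _ (laguerreSum n a _)] at h
    rw [h, if_neg (by omega), if_neg (by omega)]
  have hint : ∀ j : ℕ, IntegrableOn
      (fun x : ℝ => (x : ℂ) ^ j * Complex.exp (-(1 * x))) (Set.Ioi 0) :=
    fun j => integrableOn_pow_mul_cexp_neg_mul_Ioi (by simp) j
  simp_rw [laguerreSum_mul_eq]
  rw [integral_finsetSum _ fun j _ => integrable_finsetSum _ fun k _ => (hint _).const_mul _,
    ← sum_alternating_choose_mul_moment m n a hmn]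
  refine Finset.sum_congr rfl fun j _ => ?_
  rw [integral_finsetSum _ fun k _ => (hint _).const_mul _]
  refine Finset.sum_congr rfl fun k _ => ?_
  rw [integral_const_mul, integral_pow_mul_cexp_neg_mul_Ioi (by simp), one_pow, div_one]

theorem integral_cexp_mul_sub_I_pow_div {t : ℝ} (ht : 0 < t) (n a : ℕ) :
    ∫ ξ : ℝ, Complex.exp (-Complex.I * t * ξ) *
        ((ξ - Complex.I) ^ n / (ξ + Complex.I) ^ (n + a + 2)) =
      2 * Real.pi * (-Complex.I) ^ (a + 2) * t ^ (a + 1) * Complex.exp (-t) *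
        ∑ k ∈ Finset.range (n + 1),
          (-1) ^ k * n.choose k * (2 * t : ℂ) ^ k / (a + 1 + k).factorial := by
  have hpt : ∀ ξ : ℝ, Complex.exp (-Complex.I * t * ξ) *
        ((ξ - Complex.I) ^ n / (ξ + Complex.I) ^ (n + a + 2)) =
      ∑ k ∈ Finset.range (n + 1), ((-2 * Complex.I) ^ k * n.choose k) *
        (Complex.exp (-Complex.I * t * ξ) / (ξ + Complex.I) ^ (a + k + 2)) := by
    intro ξ
    rw [show (ξ - Complex.I : ℂ) = -2 * Complex.I + (ξ + Complex.I) by ring, add_pow,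
      Finset.sum_div, Finset.mul_sum]
    refine Finset.sum_congr rfl fun k hk => ?_
    obtain ⟨m, rfl⟩ := Nat.exists_eq_add_of_le (Nat.lt_succ_iff.mp (Finset.mem_range.mp hk))
    have h := ofReal_add_I_ne_zero ξ
    rw [Nat.add_sub_cancel_left, show k + m + a + 2 = m + (a + k + 2) by ring, pow_add _ m]
    field_simp
  simp_rw [hpt]
  rw [integral_finsetSum _ fun k _ => (integrable_cexp_div_add_I_pow t _).const_mul _,
    Finset.mul_sum]
  refine Finset.sum_congr rfl fun k _ => ?_
  have hI : (-2 * Complex.I) ^ k * (-Complex.I) ^ k = (-1) ^ k * 2 ^ k := by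
    rw [← mul_pow, ← mul_pow]
    congr 1
    linear_combination 2 * Complex.I_sq
  rw [integral_const_mul, integral_cexp_div_add_I_pow ht, show a + k + 1 = a + 1 + k by ring,
    show a + k + 2 = a + 2 + k by ring, pow_add _ (a + 2), pow_add _ (a + 1), mul_pow]
  linear_combination (n.choose k * 2 * Real.pi * (-Complex.I) ^ (a + 2) * t ^ (a + 1) * t ^ k *
    Complex.exp (-t) / (a + 1 + k).factorial) * hI

theorem Wh_integrand_eq (L n : ℕ) (y ξ : ℝ) :
    Complex.exp (-Complex.I * (y : ℂ) * (ξ : ℂ) / 2) *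
        ((ξ ^ 2 + 1 : ℝ) : ℂ) ^ (-(((L + 1 : ℕ) : ℂ) - 1 / 2) - 1 / 2) *
        Complex.exp (((L + 1 + n : ℕ) : ℂ) *
          (Complex.log ((ξ : ℂ) - Complex.I) - Complex.log ((ξ : ℂ) + Complex.I))) =
      Complex.exp (-Complex.I * (y / 2 : ℝ) * ξ) *
        ((ξ - Complex.I) ^ n / (ξ + Complex.I) ^ (n + 2 * L + 2)) := by
  have h1 := ofReal_add_I_ne_zero ξ
  have h2 : (ξ - Complex.I : ℂ) ≠ 0 := by
    intro h
    have := congrArg Complex.im h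
    simp at this
  have h3 : ((ξ ^ 2 + 1 : ℝ) : ℂ) = (ξ - Complex.I) * (ξ + Complex.I) := by
    push_cast
    linear_combination Complex.I_sq
  have h4 : -Complex.I * ((y / 2 : ℝ) : ℂ) * ξ = -Complex.I * (y : ℂ) * (ξ : ℂ) / 2 := by
    push_cast
    ring
  rw [h3, show (-(((L + 1 : ℕ) : ℂ) - 1 / 2) - 1 / 2) = -((L + 1 : ℕ) : ℂ) by ring,
    Complex.cpow_neg, Complex.cpow_natCast, Complex.exp_nat_mul, Complex.exp_sub,
    Complex.exp_log h1, Complex.exp_log h2, h4, mul_assoc]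
  congr 1
  rw [show n + 2 * L + 2 = (L + 1) + (L + 1 + n) by ring, div_pow, mul_pow,
    pow_add (ξ + Complex.I : ℂ) (L + 1) (L + 1 + n), pow_add (ξ - Complex.I : ℂ) (L + 1) n]
  field_simp

/-- Whittaker functions of the discrete series in terms of Laguerre polynomials. -/
theorem Wh_eq_laguerreSum (L n : ℕ) {y : ℝ} (hy : 0 < y) :
    Wh ((L + 1 + n : ℕ) : ℂ) (((L + 1 : ℕ) : ℂ) - 1 / 2) y =
      (-1) ^ n * (y : ℂ) ^ (L + 1) * Complex.exp (-(y / 2 : ℝ)) * laguerreSum n (2 * L + 1) y := by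
  have hexp : Complex.exp (Complex.I * (Real.pi : ℂ) * ((L + 1 + n : ℕ) : ℂ)) =
      (-1) ^ (L + 1 + n) := by
    rw [mul_comm, Complex.exp_nat_mul, mul_comm Complex.I, Complex.exp_pi_mul_I]
  have hpow : ((y / 4 : ℝ) : ℂ) ^ ((1 : ℂ) / 2 - (((L + 1 : ℕ) : ℂ) - 1 / 2)) =
      ((y / 4 : ℂ) ^ L)⁻¹ := by
    rw [show (1 : ℂ) / 2 - (((L + 1 : ℕ) : ℂ) - 1 / 2) = -(L : ℂ) by push_cast; ring,
      Complex.cpow_neg, Complex.cpow_natCast]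
    push_cast
    rfl
  have hGamma : Complex.Gamma (((L + 1 + n : ℕ) : ℂ) + (((L + 1 : ℕ) : ℂ) - 1 / 2) + 1 / 2) =
      (n + (2 * L + 1)).factorial := by
    rw [← Complex.Gamma_nat_eq_factorial]
    congr 1
    push_cast
    ring
  have hsum : laguerreSum n (2 * L + 1) y = (n + (2 * L + 1)).factorial *
      ∑ k ∈ Finset.range (n + 1),
        (-1) ^ k * n.choose k * (2 * (y / 2 : ℝ) : ℂ) ^ k / (2 * L + 1 + k).factorial := by
    rw [laguerreSum, Finset.mul_sum]
    refine Finset.sum_congr rfl fun k _ => ?_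
    rw [show (2 * (y / 2 : ℝ) : ℂ) = y by push_cast; ring]
    ring
  rw [Wh, hexp, hpow, hGamma]
  simp_rw [Wh_integrand_eq]
  rw [integral_cexp_mul_sub_I_pow_div (half_pos hy), hsum]
  have hI : (-Complex.I) ^ (2 * L + 2) = (-1) ^ (L + 1) := by
    rw [show 2 * L + 2 = 2 * (L + 1) by ring, pow_mul, neg_sq, Complex.I_sq]
  have hpi : (Real.pi : ℂ) ≠ 0 := by exact_mod_cast Real.pi_ne_zero
  have hy0 : (y : ℂ) ≠ 0 := by exact_mod_cast hy.ne'
  have hs : ((-1 : ℂ) ^ (L + 1)) * (-1) ^ (L + 1) = 1 := by rw [← mul_pow]; simp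
  have hyp : ((y / 4 : ℂ) ^ L)⁻¹ * (2 * ((y / 2 : ℝ) : ℂ) ^ (2 * L + 1)) = (y : ℂ) ^ (L + 1) := by
    push_cast
    rw [pow_succ, pow_mul, show ((y / 2 : ℂ) ^ 2) = y / 4 * y by ring, mul_pow, pow_succ]
    have : (y / 4 : ℂ) ^ L ≠ 0 := pow_ne_zero _ (by simpa using hy0)
    field_simp
  rw [hI, ← hyp, pow_add _ (L + 1) n]
  generalize ∑ k ∈ Finset.range (n + 1),
    (-1 : ℂ) ^ k * n.choose k * (2 * (y / 2 : ℝ) : ℂ) ^ k / (2 * L + 1 + k).factorial = S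
  generalize ((y / 4 : ℂ) ^ L)⁻¹ = B
  field_simp
  linear_combination ((n + (2 * L + 1)).factorial * B * ((y / 2 : ℝ) : ℂ) ^ (2 * L + 1) * S) * hs

theorem Wh_mul_Wh_div (L m n : ℕ) {y : ℝ} (hy : 0 < y) :
    Wh ((L + 1 + m : ℕ) : ℂ) (((L + 1 : ℕ) : ℂ) - 1 / 2) y *
        Wh ((L + 1 + n : ℕ) : ℂ) (((L + 1 : ℕ) : ℂ) - 1 / 2) y / (y : ℂ) =
      (-1) ^ (m + n) * ((y : ℂ) ^ (2 * L + 1) * Complex.exp (-y) *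
        laguerreSum m (2 * L + 1) y * laguerreSum n (2 * L + 1) y) := by
  have hy0 : (y : ℂ) ≠ 0 := by exact_mod_cast hy.ne'
  have he : Complex.exp (-y) = Complex.exp (-(y / 2 : ℝ)) * Complex.exp (-(y / 2 : ℝ)) := by
    rw [← Complex.exp_add]
    congr 1
    push_cast
    ring
  rw [Wh_eq_laguerreSum L m hy, Wh_eq_laguerreSum L n hy, he]
  field_simp
  ring

/-- Orthogonality and norm of discrete-series Whittaker functions. -/
theorem whittaker_discrete_series_orthogonality (l : ℕ) (hl : 1 ≤ l) (ℓ ℓ' : ℤ)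
    (hℓ : (l : ℤ) ≤ ℓ) (hℓ' : (l : ℤ) ≤ ℓ') :
    IntegrableOn (fun y : ℝ =>
      Wh (ℓ : ℂ) ((l : ℂ) - 1 / 2) y * Wh (ℓ' : ℂ) ((l : ℂ) - 1 / 2) y / (y : ℂ))
      (Set.Ioi 0) ∧
    (∫ y in Set.Ioi (0 : ℝ),
        Wh (ℓ : ℂ) ((l : ℂ) - 1 / 2) y * Wh (ℓ' : ℂ) ((l : ℂ) - 1 / 2) y / (y : ℂ)) =
      if ℓ = ℓ' then Complex.Gamma ((ℓ : ℂ) - (l : ℂ) + 1) * Complex.Gamma ((ℓ : ℂ) + (l : ℂ))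
      else 0 := by
  obtain ⟨L, rfl⟩ := Nat.exists_eq_add_of_le' hl
  obtain ⟨m, rfl⟩ := Int.le.dest hℓ
  obtain ⟨n, rfl⟩ := Int.le.dest hℓ'
  have hcast : ∀ k : ℕ, (((((L + 1 : ℕ) : ℤ) + (k : ℤ) : ℤ)) : ℂ) = ((L + 1 + k : ℕ) : ℂ) :=
    fun k => by push_cast; rfl
  simp_rw [hcast]
  have hcongr : Set.EqOn (fun y : ℝ => Wh ((L + 1 + m : ℕ) : ℂ) (((L + 1 : ℕ) : ℂ) - 1 / 2) y *
      Wh ((L + 1 + n : ℕ) : ℂ) (((L + 1 : ℕ) : ℂ) - 1 / 2) y / (y : ℂ)) _ (Set.Ioi 0) :=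
    fun y hy => Wh_mul_Wh_div L m n hy
  refine ⟨(IntegrableOn.congr_fun ((integrableOn_laguerreSum_mul m n _).const_mul _)
    hcongr.symm measurableSet_Ioi), ?_⟩
  rw [setIntegral_congr_fun measurableSet_Ioi hcongr, integral_const_mul,
    integral_laguerreSum_mul]
  by_cases hmn : m = n
  · subst hmn
    have h1 : ((L + 1 + m : ℕ) : ℂ) - ((L + 1 : ℕ) : ℂ) + 1 = (m : ℂ) + 1 := by
      push_cast
      ring
    have h2 : ((L + 1 + m : ℕ) : ℂ) + ((L + 1 : ℕ) : ℂ) = ((m + (2 * L + 1) : ℕ) : ℂ) + 1 := by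
      push_cast
      ring
    rw [if_pos rfl, if_pos rfl, h1, h2, Complex.Gamma_nat_eq_factorial,
      Complex.Gamma_nat_eq_factorial, ← two_mul, pow_mul, neg_one_sq, one_pow, one_mul]
  · rw [if_neg hmn, if_neg (by omega), mul_zero]
end
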